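/- Let K, T, S be positive integers with S ≤ T and KT > S, let ℓ_1, …, ℓ_T ∈ [0,1]^K, and set η = √(S·log(KT/S)/T). Define w_1 = (1/K, …, 1/K), and for each t ∈ {1,…,T} let w_{t+1} be the minimizer over the clipped simplex Δ̃_K of w ↦ ⟨w, ηℓ_t⟩ + D_φ(w‖w_t). Then for every comparator sequence (E_1,…,E_T) ∈ [K]^T with at most S−1 switches, ∑_{t=1}^T ⟨w_t, ℓ_t⟩ − ∑_{t=1}^T ℓ_t[E_t] ≤ 2√(S·T·log(KT/S)) + S. -/

import Mathlib

open Finset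

/-- The probability simplex in `ℝ^K`. -/
def stdSimplex' (K : ℕ) : Set (Fin K → ℝ) :=
  {w | (∀ i, 0 ≤ w i) ∧ ∑ i, w i = 1}

/-- The clipped simplex `Δ̃_K = {w ∈ Δ_K : w i ≥ S/(TK)}`. -/
def clippedSimplex (K T S : ℕ) : Set (Fin K → ℝ) :=
  {w | w ∈ stdSimplex' K ∧ ∀ i, (S : ℝ) / (T * K) ≤ w i}

/-- The negative Shannon entropy `φ(w) = ∑ i, w i * log (w i)`. -/
noncomputable def negEntropy {K : ℕ} (w : Fin K → ℝ) : ℝ :=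
  ∑ i, w i * Real.log (w i)

/-- The Bregman divergence with respect to the negative Shannon entropy. -/
noncomputable def breg {K : ℕ} (x y : Fin K → ℝ) : ℝ :=
  negEntropy x - negEntropy y - ∑ i, (x i - y i) * (1 + Real.log (y i))

/-- The standard inner product on `ℝ^K`. -/
def ip {K : ℕ} (x y : Fin K → ℝ) : ℝ := ∑ i, x i * y i

lemma breg_eq_sum {K : ℕ} (x y : Fin K → ℝ) :
    breg x y = ∑ i, (x i * (Real.log (x i) - Real.log (y i)) - x i + y i) := by
  unfold breg negEntropy
  rw [← Finset.sum_sub_distrib, ← Finset.sum_sub_distrib]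
  exact Finset.sum_congr rfl fun i _ => by ring

lemma sub_le_mul_log_sub_log {x y : ℝ} (hx : 0 < x) (hy : 0 < y) :
    x - y ≤ x * (Real.log x - Real.log y) := by
  have h := Real.log_le_sub_one_of_pos (div_pos hy hx)
  rw [Real.log_div hy.ne' hx.ne'] at h
  have h' := mul_le_mul_of_nonneg_left h hx.le
  have e : x * (y / x - 1) = y - x := by field_simp
  linarith

lemma mul_log_sub_log_le {x y : ℝ} (hx : 0 < x) (hy : 0 < y) :
    x * (Real.log x - Real.log y) ≤ x - y + (x - y) ^ 2 / y := by
  have h := Real.log_le_sub_one_of_pos (div_pos hx hy)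
  rw [Real.log_div hx.ne' hy.ne'] at h
  have h' := mul_le_mul_of_nonneg_left h hx.le
  have e : x * (x / y - 1) = x - y + (x - y) ^ 2 / y := by field_simp; ring
  linarith

lemma breg_nonneg {K : ℕ} {x y : Fin K → ℝ} (hx : ∀ i, 0 < x i) (hy : ∀ i, 0 < y i) :
    0 ≤ breg x y := by
  rw [breg_eq_sum]
  exact Finset.sum_nonneg fun i _ => by linarith [sub_le_mul_log_sub_log (hx i) (hy i)]

lemma breg_le_sum_sq_div {K : ℕ} {x y : Fin K → ℝ} (hx : ∀ i, 0 < x i) (hy : ∀ i, 0 < y i) :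
    breg x y ≤ ∑ i, (x i - y i) ^ 2 / y i := by
  rw [breg_eq_sum]
  exact Finset.sum_le_sum fun i _ => by linarith [mul_log_sub_log_le (hx i) (hy i)]

lemma breg_three_point {K : ℕ} (u x y : Fin K → ℝ) :
    breg u y - breg u x - breg x y =
      ∑ i, (u i - x i) * (Real.log (x i) - Real.log (y i)) := by
  simp only [breg_eq_sum, ← Finset.sum_sub_distrib]
  exact Finset.sum_congr rfl fun i _ => by ring

lemma nonneg_of_forall_add_mul_nonneg {a b : ℝ}
    (h : ∀ ε : ℝ, 0 < ε → ε ≤ 1 → 0 ≤ a + ε * b) : 0 ≤ a := by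
  by_contra! ha
  have hb : 0 < |b| + 1 := by positivity
  have hε : 0 < min 1 (-a / (2 * (|b| + 1))) := lt_min one_pos (by apply div_pos <;> linarith)
  have h1 := h _ hε (min_le_left _ _)
  have h2 : min 1 (-a / (2 * (|b| + 1))) * b ≤ -a / (2 * (|b| + 1)) * (|b| + 1) :=
    calc _ ≤ min 1 (-a / (2 * (|b| + 1))) * (|b| + 1) :=
          mul_le_mul_of_nonneg_left (by linarith [le_abs_self b]) hε.le
      _ ≤ _ := mul_le_mul_of_nonneg_right (min_le_right _ _) hb.le
  have h3 : -a / (2 * (|b| + 1)) * (|b| + 1) = -a / 2 := by field_simp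
  linarith

/-- The Bregman proximal inequality for a minimizer with positive entries. -/
lemma ip_sub_le_of_isMinOn {K : ℕ} {C : Set (Fin K → ℝ)} (hC : Convex ℝ C)
    (hpos : ∀ v ∈ C, ∀ i, 0 < v i) {x y c : Fin K → ℝ} (hx : x ∈ C)
    (hmin : ∀ v ∈ C, ip x c + breg x y ≤ ip v c + breg v y) {u : Fin K → ℝ} (hu : u ∈ C) :
    ip x c - ip u c ≤ breg u y - breg u x - breg x y := by
  rw [breg_three_point]
  suffices h : 0 ≤ ip u c - ip x c +
      ∑ i, (u i - x i) * (Real.log (x i) - Real.log (y i)) by linarith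
  refine nonneg_of_forall_add_mul_nonneg (b := ∑ i, (u i - x i) ^ 2 / x i) fun ε hε hε1 => ?_
  have hv : x + ε • (u - x) ∈ C := hC.add_smul_sub_mem hx hu ⟨hε.le, hε1⟩
  have h1 := hmin _ hv
  have h2 := breg_three_point (x + ε • (u - x)) x y
  have h3 := breg_le_sum_sq_div (hpos _ hv) (hpos _ hx)
  have e1 : ip (x + ε • (u - x)) c = ip x c + ε * (ip u c - ip x c) := by
    simp only [ip, ← Finset.sum_sub_distrib, Finset.mul_sum, ← Finset.sum_add_distrib]
    exact Finset.sum_congr rfl fun i _ => by simp; ring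
  have e2 : ∑ i, ((x + ε • (u - x)) i - x i) * (Real.log (x i) - Real.log (y i)) =
      ε * ∑ i, (u i - x i) * (Real.log (x i) - Real.log (y i)) := by
    rw [Finset.mul_sum]
    exact Finset.sum_congr rfl fun i _ => by simp; ring
  have e3 : ∑ i, ((x + ε • (u - x)) i - x i) ^ 2 / x i =
      ε * (ε * ∑ i, (u i - x i) ^ 2 / x i) := by
    rw [Finset.mul_sum, Finset.mul_sum]
    exact Finset.sum_congr rfl fun i _ => by simp; ring
  refine (mul_nonneg_iff_of_pos_left hε).1 ?_
  linarith

lemma exp_neg_le_one_sub_add_sq {c : ℝ} (hc : 0 ≤ c) : Real.exp (-c) ≤ 1 - c + c ^ 2 := by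
  have h1 : Real.exp (-c) * Real.exp c = 1 := by rw [← Real.exp_add]; simp
  have h2 := mul_le_mul_of_nonneg_left (Real.add_one_le_exp c) (Real.exp_pos (-c)).le
  have h3 : 0 ≤ c ^ 3 := by positivity
  nlinarith

lemma sub_mul_sub_log_le {x y c : ℝ} (hx : 0 < x) (hy : 0 < y) (hc : 0 ≤ c) :
    (y - x) * c - (x * (Real.log x - Real.log y) - x + y) ≤ y * c ^ 2 := by
  have h := sub_le_mul_log_sub_log hx (mul_pos hy (Real.exp_pos (-c)))
  rw [Real.log_mul hy.ne' (Real.exp_pos _).ne', Real.log_exp] at h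
  have h' := mul_le_mul_of_nonneg_left (exp_neg_le_one_sub_add_sq hc) hy.le
  linarith

lemma ip_sub_breg_le {K : ℕ} {x y ℓ : Fin K → ℝ} (hx : ∀ i, 0 < x i) (hy : ∀ i, 0 < y i)
    (hy1 : ∑ i, y i = 1) (hℓ : ∀ i, ℓ i ∈ Set.Icc (0 : ℝ) 1) {η : ℝ} (hη : 0 ≤ η) :
    ip y (η • ℓ) - ip x (η • ℓ) - breg x y ≤ η ^ 2 := by
  rw [breg_eq_sum]
  simp only [ip, ← Finset.sum_sub_distrib]
  rw [← one_mul (η ^ 2), ← hy1, Finset.sum_mul]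
  refine Finset.sum_le_sum fun i _ => ?_
  have hc : 0 ≤ η * ℓ i := mul_nonneg hη (hℓ i).1
  have h1 := sub_mul_sub_log_le (hx i) (hy i) hc
  have h2 : (η * ℓ i) ^ 2 ≤ η ^ 2 :=
    pow_le_pow_left₀ hc (mul_le_of_le_one_right hη (hℓ i).2) 2
  have h3 := mul_le_mul_of_nonneg_left h2 (hy i).le
  simp only [Pi.smul_apply, smul_eq_mul]
  linarith

lemma convex_clippedSimplex (K T S : ℕ) : Convex ℝ (clippedSimplex K T S) := by
  rintro x ⟨⟨hx0, hx1⟩, hx⟩ y ⟨⟨hy0, hy1⟩, hy⟩ a b ha hb hab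
  refine ⟨⟨fun i => ?_, ?_⟩, fun i => ?_⟩
  · exact add_nonneg (mul_nonneg ha (hx0 i)) (mul_nonneg hb (hy0 i))
  · simp [Finset.sum_add_distrib, ← Finset.mul_sum, hx1, hy1, hab]
  · have h1 := mul_le_mul_of_nonneg_left (hx i) ha
    have h2 := mul_le_mul_of_nonneg_left (hy i) hb
    have h3 : (a + b) * ((S : ℝ) / (T * K)) = S / (T * K) := by rw [hab, one_mul]
    simp only [Pi.add_apply, Pi.smul_apply, smul_eq_mul]
    linarith

lemma pos_of_mem_clippedSimplex {K T S : ℕ} (hK : 0 < K) (hT : 0 < T) (hS : 0 < S)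
    {v : Fin K → ℝ} (hv : v ∈ clippedSimplex K T S) (i : Fin K) : 0 < v i :=
  lt_of_lt_of_le (by positivity) (hv.2 i)

lemma breg_le_log {K T S : ℕ} (hK : 0 < K) (hT : 0 < T) (hS : 0 < S) {u v : Fin K → ℝ}
    (hu : u ∈ clippedSimplex K T S) (hv : v ∈ clippedSimplex K T S) :
    breg u v ≤ Real.log (K * T / S) := by
  have hL : -Real.log ((S : ℝ) / (T * K)) = Real.log (K * T / S) := by
    rw [← Real.log_inv, inv_div, mul_comm (T : ℝ)]
  have h : breg u v ≤ ∑ i, (u i * Real.log (K * T / S) - u i + v i) := by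
    rw [breg_eq_sum]
    refine Finset.sum_le_sum fun i _ => ?_
    have hui := pos_of_mem_clippedSimplex hK hT hS hu i
    have h1 : u i ≤ 1 := hu.1.2 ▸ Finset.single_le_sum (fun j _ => hu.1.1 j) (Finset.mem_univ i)
    have h2 := Real.log_nonpos hui.le h1
    have h3 := Real.log_le_log (by positivity) (hv.2 i)
    have h4 : Real.log (u i) - Real.log (v i) ≤ Real.log (K * T / S) := by linarith
    linarith [mul_le_mul_of_nonneg_left h4 hui.le]
  rw [Finset.sum_add_distrib, Finset.sum_sub_distrib, ← Finset.sum_mul, hu.1.2, hv.1.2] at h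
  linarith

/-- The vertex `j` of the simplex, mixed with weight `S / T` with the uniform distribution. -/
noncomputable def mixedVertex (K T S : ℕ) (j : Fin K) : Fin K → ℝ :=
  fun i => (1 - S / T) * (if i = j then 1 else 0) + S / (T * K)

lemma mixedVertex_mem {K T S : ℕ} (hK : 0 < K) (hT : 0 < T) (hST : S ≤ T) (j : Fin K) :
    mixedVertex K T S j ∈ clippedSimplex K T S := by
  have hT' : (0 : ℝ) < T := by exact_mod_cast hT
  have h1 : (S : ℝ) / T ≤ 1 := (div_le_one hT').2 (by exact_mod_cast hST)
  have h2 : ∀ i, 0 ≤ (1 - (S : ℝ) / T) * (if i = j then 1 else 0) := fun i =>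
    mul_nonneg (by linarith) (by split_ifs <;> norm_num)
  refine ⟨⟨fun i => add_nonneg (h2 i) (by positivity), ?_⟩, fun i =>
    le_add_of_nonneg_left (h2 i)⟩
  simp only [mixedVertex, Finset.sum_add_distrib, ← Finset.mul_sum, Finset.sum_ite_eq',
    Finset.mem_univ, if_true, Finset.sum_const, Finset.card_univ, Fintype.card_fin, nsmul_eq_mul]
  field_simp
  ring

lemma ip_mixedVertex_le {K T S : ℕ} (hK : 0 < K) (hT : 0 < T) (j : Fin K)
    {ℓ : Fin K → ℝ} (hℓ : ∀ i, ℓ i ∈ Set.Icc (0 : ℝ) 1) :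
    ip (mixedVertex K T S j) ℓ ≤ ℓ j + S / T := by
  have e : ip (mixedVertex K T S j) ℓ = (1 - S / T) * ℓ j + S / (T * K) * ∑ i, ℓ i := by
    simp [ip, mixedVertex, add_mul, Finset.sum_add_distrib, Finset.mul_sum]
  have h1 : ∑ i, ℓ i ≤ K := by
    simpa using Finset.sum_le_sum fun i (_ : i ∈ Finset.univ) => (hℓ i).2
  have h2 : (S : ℝ) / (T * K) * ∑ i, ℓ i ≤ S / (T * K) * K :=
    mul_le_mul_of_nonneg_left h1 (by positivity)
  have h3 : (S : ℝ) / (T * K) * K = S / T := by field_simp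
  have h4 : 0 ≤ (S : ℝ) / T * ℓ j := mul_nonneg (by positivity) (hℓ j).1
  linarith

lemma sum_sub_le_switches {α : Type*} [DecidableEq α] (E : ℕ → α) (D : α → ℕ → ℝ) {L : ℝ} (n : ℕ)
    (h0 : ∀ a, ∀ t ∈ Finset.Icc 1 (n + 2), 0 ≤ D a t)
    (hL : ∀ a, ∀ t ∈ Finset.Icc 1 (n + 2), D a t ≤ L) :
    ∑ t ∈ Finset.Icc 1 (n + 1), (D (E t) t - D (E t) (t + 1)) ≤
      L * (1 + ((Finset.Icc 2 (n + 1)).filter fun t => E t ≠ E (t - 1)).card)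
        - D (E (n + 1)) (n + 2) := by
  induction n with
  | zero => simpa using hL (E 1) 1 (by simp)
  | succ n ih =>
    have hmono : ∀ t ∈ Finset.Icc 1 (n + 2), t ∈ Finset.Icc 1 (n + 1 + 2) := fun t ht => by
      simp only [Finset.mem_Icc] at ht ⊢; omega
    have ih := ih (fun a t ht => h0 a t (hmono t ht)) fun a t ht => hL a t (hmono t ht)
    have hmem : n + 2 ∈ Finset.Icc 1 (n + 1 + 2) := by simp
    rw [Finset.sum_Icc_succ_top (by omega),
      ← Finset.insert_Icc_right_eq_Icc_add_one (by omega : 2 ≤ n + 1 + 1), Finset.filter_insert]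
    by_cases hE : E (n + 1 + 1) = E (n + 1)
    · rw [if_neg (by simpa using hE)]
      rw [hE]
      linarith
    · rw [if_pos (by simpa using hE), Finset.card_insert_of_notMem (by simp)]
      push_cast
      linarith [hL (E (n + 2)) _ hmem, h0 (E (n + 1)) _ hmem]

theorem omd_clipped_tracking_regret_tuned
    (K T S : ℕ) (hK : 0 < K) (hT : 0 < T) (hS : 0 < S) (hST : S ≤ T) (hKTS : S < K * T)
    (ℓ : ℕ → Fin K → ℝ)
    (hℓ : ∀ t ∈ Finset.Icc 1 T, ∀ i, ℓ t i ∈ Set.Icc (0 : ℝ) 1)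
    (η : ℝ) (hη : η = Real.sqrt (S * Real.log (K * T / S) / T))
    (w : ℕ → Fin K → ℝ)
    (hw1 : w 1 = fun _ => (K : ℝ)⁻¹)
    (hmin : ∀ t ∈ Finset.Icc 1 T,
      w (t + 1) ∈ clippedSimplex K T S ∧
      ∀ v ∈ clippedSimplex K T S,
        ip (w (t + 1)) (η • ℓ t) + breg (w (t + 1)) (w t)
          ≤ ip v (η • ℓ t) + breg v (w t))
    (E : ℕ → Fin K)
    (hE : ((Finset.Icc 2 T).filter (fun t => E t ≠ E (t - 1))).card ≤ S - 1) :
    ∑ t ∈ Finset.Icc 1 T, ip (w t) (ℓ t) - ∑ t ∈ Finset.Icc 1 T, ℓ t (E t)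
      ≤ 2 * Real.sqrt (S * T * Real.log (K * T / S)) + S := by
  have hK' : (0 : ℝ) < K := by exact_mod_cast hK
  have hT' : (0 : ℝ) < T := by exact_mod_cast hT
  have hS' : (0 : ℝ) < S := by exact_mod_cast hS
  set L := Real.log (K * T / S) with hLdef
  have hL : 0 < L := Real.log_pos ((one_lt_div hS').2 (by exact_mod_cast hKTS))
  have hη0 : 0 < η := hη ▸ Real.sqrt_pos.2 (by positivity)
  have hη2 : T * η ^ 2 = S * L := by
    rw [hη, Real.sq_sqrt (by positivity)]; field_simp
  have hsqrt : Real.sqrt (S * T * L) = T * η := by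
    rw [show (S : ℝ) * T * L = (T * η) ^ 2 by linear_combination (-(T : ℝ)) * hη2]
    exact Real.sqrt_sq (by positivity)
  have hw : ∀ t ∈ Finset.Icc 1 (T + 1), w t ∈ clippedSimplex K T S := by
    intro t ht
    rw [Finset.mem_Icc] at ht
    obtain rfl | h := eq_or_lt_of_le ht.1
    · rw [hw1]
      refine ⟨⟨fun i => by positivity, by simp [hK.ne']⟩, fun i => ?_⟩
      rw [inv_eq_one_div, div_le_div_iff₀ (by positivity) hK', one_mul]
      exact mul_le_mul_of_nonneg_right (by exact_mod_cast hST) hK'.le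
    · obtain ⟨s, rfl⟩ : ∃ s, t = s + 1 := ⟨t - 1, by omega⟩
      exact (hmin s (Finset.mem_Icc.2 (by omega))).1
  have hpos : ∀ v ∈ clippedSimplex K T S, ∀ i, 0 < v i := fun v hv =>
    pos_of_mem_clippedSimplex hK hT hS hv
  have hu := mixedVertex_mem hK hT hST
  have hstep : ∀ t ∈ Finset.Icc 1 T, η * (ip (w t) (ℓ t) - ℓ t (E t)) ≤
      breg (mixedVertex K T S (E t)) (w t) - breg (mixedVertex K T S (E t)) (w (t + 1))
        + (η ^ 2 + η * (S / T)) := by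
    intro t ht
    have ht' := Finset.mem_Icc.1 ht
    have hwt := hw t (Finset.mem_Icc.2 (by omega))
    have h1 := ip_sub_le_of_isMinOn (convex_clippedSimplex K T S) hpos (hmin t ht).1
      (hmin t ht).2 (hu (E t))
    have h2 := ip_sub_breg_le (hpos _ (hmin t ht).1) (hpos _ hwt) hwt.1.2 (hℓ t ht) hη0.le
    have h3 := mul_le_mul_of_nonneg_left
      (ip_mixedVertex_le (S := S) hK hT (E t) (hℓ t ht)) hη0.le
    have e : ∀ v, ip v (η • ℓ t) = η * ip v (ℓ t) := fun v => by
      simp only [ip, Finset.mul_sum, Pi.smul_apply, smul_eq_mul]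
      exact Finset.sum_congr rfl fun i _ => by ring
    simp only [e] at h1 h2
    linarith
  have hswitch : ∑ t ∈ Finset.Icc 1 T, (breg (mixedVertex K T S (E t)) (w t) -
      breg (mixedVertex K T S (E t)) (w (t + 1))) ≤ S * L := by
    obtain ⟨n, rfl⟩ : ∃ n, T = n + 1 := ⟨T - 1, by omega⟩
    have h := sum_sub_le_switches E (fun j t => breg (mixedVertex K (n + 1) S j) (w t)) n
      (fun j t ht => breg_nonneg (hpos _ (hu j)) (hpos _ (hw t ht)))
      (fun j t ht => breg_le_log hK hT hS (hu j) (hw t ht))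
    have h0 := breg_nonneg (hpos _ (hu (E (n + 1)))) (hpos _ (hw (n + 2) (by simp)))
    have hc : (1 : ℝ) + ((Finset.Icc 2 (n + 1)).filter fun t => E t ≠ E (t - 1)).card ≤ S := by
      exact_mod_cast (by omega :
        1 + ((Finset.Icc 2 (n + 1)).filter fun t => E t ≠ E (t - 1)).card ≤ S)
    have h1 := mul_le_mul_of_nonneg_left hc hL.le
    linarith
  have hsum := Finset.sum_le_sum hstep
  rw [Finset.sum_add_distrib, ← Finset.mul_sum, Finset.sum_sub_distrib, Finset.sum_const,
    Nat.card_Icc, Nat.add_sub_cancel, nsmul_eq_mul] at hsum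
  have e : (T : ℝ) * (η ^ 2 + η * (S / T)) = T * η ^ 2 + η * S := by field_simp
  rw [hsqrt]
  refine le_of_mul_le_mul_left ?_ hη0
  linarith
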